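/- For every positive real number a, ∫_ℝ e^{-x²/(4a)}/(cosh a − cos x) dx = (2√(πa)/sinh a)·(1 + 2·Σ_{n=1}^{∞} e^{-a·n(n+1)}). -/

import Mathlib

open MeasureTheory Real Filter

/-- The Fourier expansion of the Poisson kernel, with radius `exp (-a)`. -/
theorem hasSum_exp_neg_mul_cos {a : ℝ} (ha : 0 < a) (x : ℝ) :
    HasSum (fun n : ℕ => Real.exp (-a * ((n : ℝ) + 1)) * Real.cos (((n : ℝ) + 1) * x))
      ((Real.sinh a / (Real.cosh a - Real.cos x) - 1) / 2) := by
  have hcosh : 0 < Real.cosh a - Real.cos x := by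
    linarith [Real.one_lt_cosh.mpr ha.ne', Real.cos_le_one x]
  set z : ℂ := Complex.exp (-a + x * Complex.I) with hz
  have hre : z.re = Real.exp (-a) * Real.cos x := by simp [hz, Complex.exp_re]
  have him : z.im = Real.exp (-a) * Real.sin x := by simp [hz, Complex.exp_im]
  have hnorm : ‖z‖ < 1 := by simp [hz, Complex.norm_exp, ha]
  have hsum := Complex.hasSum_re ((hasSum_geometric_of_norm_lt_one hnorm).mul_left z)
  convert hsum using 1
  · funext n
    have hpow : z * z ^ n =
        Complex.exp ((-a * ((n : ℝ) + 1) : ℝ) + (((n : ℝ) + 1) * x : ℝ) * Complex.I) := by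
      rw [← pow_succ', hz, ← Complex.exp_nat_mul]
      congr 1
      push_cast
      ring
    rw [hpow, Complex.exp_re]
    simp
  · have hq := Real.exp_pos (-a)
    have hq' : Real.exp a = (Real.exp (-a))⁻¹ := by rw [Real.exp_neg, inv_inv]
    have hsq := Real.sin_sq_add_cos_sq x
    rw [Complex.mul_re, Complex.inv_re, Complex.inv_im, Complex.normSq_apply]
    simp only [Complex.sub_re, Complex.sub_im, Complex.one_re, Complex.one_im, hre, him]
    rw [Real.cosh_eq, hq'] at hcosh
    rw [Real.sinh_eq, Real.cosh_eq, hq']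
    generalize Real.exp (-a) = q at *
    have hden : (1 - q * Real.cos x) * (1 - q * Real.cos x) +
        (0 - q * Real.sin x) * (0 - q * Real.sin x) =
          2 * q * ((q⁻¹ + q) / 2 - Real.cos x) := by
      field_simp
      linear_combination q ^ 2 * hsq
    rw [hden]
    have hne := hcosh.ne'
    generalize hD : (q⁻¹ + q) / 2 - Real.cos x = D at *
    have hc : Real.cos x = (q⁻¹ + q) / 2 - D := by linarith
    have hs : Real.sin x ^ 2 = 1 - ((q⁻¹ + q) / 2 - D) ^ 2 := by rw [← hc]; linarith
    rw [hc]
    field_simp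
    field_simp at hs
    ring_nf at hs ⊢
    linear_combination hs

/-- The cosine transform of a Gaussian. -/
theorem integral_exp_neg_sq_div_mul_cos {a : ℝ} (ha : 0 < a) (t : ℝ) :
    ∫ x : ℝ, Real.exp (-x ^ 2 / (4 * a)) * Real.cos (t * x) =
      2 * Real.sqrt (π * a) * Real.exp (-a * t ^ 2) := by
  have hb : 0 < ((1 / (4 * a) : ℝ) : ℂ).re := by
    rw [Complex.ofReal_re]
    positivity
  have h := fourierIntegral_gaussian hb t
  have hint : Integrable fun x : ℝ =>
      Complex.exp (Complex.I * t * x) * Complex.exp (-((1 / (4 * a) : ℝ) : ℂ) * x ^ 2) := by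
    have := GaussianFourier.integrable_cexp_neg_mul_sq_add_real_mul_I hb 0
    simp only [Complex.ofReal_zero, zero_mul, add_zero] at this
    refine this.bdd_mul (c := 1) (by fun_prop) (ae_of_all _ fun x => ?_)
    simp [Complex.norm_exp]
  have hre := congrArg Complex.re h
  rw [← RCLike.re_eq_complex_re, ← integral_re hint] at hre
  convert hre using 1
  · congr 1
    funext x
    have : Complex.exp (Complex.I * t * x) * Complex.exp (-((1 / (4 * a) : ℝ) : ℂ) * x ^ 2) =
        Complex.exp ((-x ^ 2 / (4 * a) : ℝ) + (t * x : ℝ) * Complex.I) := by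
      rw [← Complex.exp_add]
      congr 1
      push_cast
      ring
    rw [this, RCLike.re_eq_complex_re, Complex.exp_re]
    simp only [Complex.add_re, Complex.add_im, Complex.re_ofReal_mul, Complex.im_ofReal_mul,
      Complex.ofReal_re, Complex.ofReal_im, Complex.I_re, Complex.I_im, mul_zero, mul_one,
      add_zero, zero_add]
  · have h1 : ((π : ℂ) / ((1 / (4 * a) : ℝ) : ℂ)) ^ (1 / 2 : ℂ) =
        ((2 * Real.sqrt (π * a) : ℝ) : ℂ) := by
      have : 2 * Real.sqrt (π * a) = (π / (1 / (4 * a))) ^ (1 / 2 : ℝ) := by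
        rw [← Real.sqrt_eq_rpow, show π / (1 / (4 * a)) = 2 ^ 2 * (π * a) by field_simp; ring,
          Real.sqrt_mul (by norm_num) (π * a), Real.sqrt_sq (by norm_num)]
      rw [this, Complex.ofReal_cpow (by positivity)]
      push_cast
      rfl
    have h2 : -(t : ℂ) ^ 2 / (4 * ((1 / (4 * a) : ℝ) : ℂ)) = ((-a * t ^ 2 : ℝ) : ℂ) := by
      have : (a : ℂ) ≠ 0 := by exact_mod_cast ha.ne'
      push_cast
      field_simp
    rw [h1, h2, ← Complex.ofReal_exp, ← Complex.ofReal_mul, RCLike.re_eq_complex_re,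
      Complex.ofReal_re]

/-- For `a > 0`,
`∫_ℝ e^{-x²/(4a)}/(cosh a − cos x) dx = (2√(πa)/sinh a)(1 + 2 ∑_{n ≥ 1} e^{-an(n+1)})`. -/
theorem integral_gaussian_div_cosh_sub_cos_self (a : ℝ) (ha : 0 < a) :
    ∫ x : ℝ, Real.exp (-x ^ 2 / (4 * a)) / (Real.cosh a - Real.cos x) =
      2 * Real.sqrt (π * a) / Real.sinh a *
        (1 + 2 * ∑' n : ℕ, Real.exp (-a * (((n : ℝ) + 1) * ((n : ℝ) + 2)))) := by
  have hsinh : Real.sinh a ≠ 0 := (Real.sinh_pos_iff.mpr ha).ne'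
  have hgauss : Integrable fun x : ℝ => Real.exp (-x ^ 2 / (4 * a)) := by
    convert integrable_exp_neg_mul_sq (show 0 < 1 / (4 * a) by positivity) using 3
    ring
  have hgauss_integral : ∫ x : ℝ, Real.exp (-x ^ 2 / (4 * a)) = 2 * Real.sqrt (π * a) := by
    simpa using integral_exp_neg_sq_div_mul_cos ha 0
  let F : ℕ → ℝ → ℝ := fun n x => Real.exp (-x ^ 2 / (4 * a)) *
    (Real.exp (-a * ((n : ℝ) + 1)) * Real.cos (((n : ℝ) + 1) * x))
  have hF_bound (n : ℕ) (x : ℝ) :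
      ‖F n x‖ ≤ Real.exp (-x ^ 2 / (4 * a)) * Real.exp (-a * ((n : ℝ) + 1)) := by
    simp only [F, norm_mul, Real.norm_eq_abs, Real.abs_exp]
    gcongr
    exact mul_le_of_le_one_right (Real.exp_pos _).le (Real.abs_cos_le_one _)
  have hF_int (n : ℕ) : Integrable (F n) :=
    (hgauss.mul_const _).mono' (by fun_prop) (ae_of_all _ (hF_bound n))
  have hF_summable : Summable fun n => ∫ x, ‖F n x‖ := by
    have hgeom : Summable fun n : ℕ => Real.exp (-a * ((n : ℝ) + 1)) := by
      simpa using (hasSum_exp_neg_mul_cos ha 0).summable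
    refine (hgeom.mul_left (2 * Real.sqrt (π * a))).of_nonneg_of_le
      (fun n => integral_nonneg fun x => norm_nonneg _) fun n => ?_
    rw [← hgauss_integral, ← integral_mul_const]
    exact integral_mono (hF_int n).norm (hgauss.mul_const _) (hF_bound n)
  have hF_integral (n : ℕ) : ∫ x, F n x =
      2 * Real.sqrt (π * a) * Real.exp (-a * (((n : ℝ) + 1) * ((n : ℝ) + 2))) := by
    have hF : F n = fun x => Real.exp (-a * ((n : ℝ) + 1)) *
        (Real.exp (-x ^ 2 / (4 * a)) * Real.cos (((n : ℝ) + 1) * x)) := by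
      funext x
      simp only [F]
      ring
    rw [hF, integral_const_mul, integral_exp_neg_sq_div_mul_cos ha, mul_left_comm,
      ← Real.exp_add]
    ring_nf
  have hF_tsum (x : ℝ) : ∑' n, F n x = Real.exp (-x ^ 2 / (4 * a)) *
      ((Real.sinh a / (Real.cosh a - Real.cos x) - 1) / 2) :=
    ((hasSum_exp_neg_mul_cos ha x).mul_left _).tsum_eq
  have hF_tsum_int : Integrable fun x => ∑' n, F n x := by
    simp_rw [hF_tsum]
    have hmeas : Measurable fun x => (Real.sinh a / (Real.cosh a - Real.cos x) - 1) / 2 :=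
      ((measurable_const.div (by fun_prop)).sub_const 1).div_const 2
    refine hgauss.mul_bdd (c := (Real.sinh a / (Real.cosh a - Real.cos 0) - 1) / 2)
      hmeas.aestronglyMeasurable (ae_of_all _ fun x => ?_)
    rw [← (hasSum_exp_neg_mul_cos ha x).tsum_eq]
    refine tsum_of_norm_bounded (hasSum_exp_neg_mul_cos ha 0) fun n => ?_
    rw [norm_mul, Real.norm_eq_abs, Real.abs_exp, mul_zero, Real.cos_zero]
    gcongr
    exact Real.abs_cos_le_one _
  have hsplit (x : ℝ) : Real.exp (-x ^ 2 / (4 * a)) / (Real.cosh a - Real.cos x) =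
      (Real.sinh a)⁻¹ * (Real.exp (-x ^ 2 / (4 * a)) + 2 * ∑' n, F n x) := by
    rw [hF_tsum]
    field_simp
    ring
  simp_rw [hsplit]
  rw [integral_const_mul, integral_add hgauss (hF_tsum_int.const_mul 2), integral_const_mul,
    ← integral_tsum_of_summable_integral_norm hF_int hF_summable, hgauss_integral]
  simp_rw [hF_integral, tsum_mul_left]
  ring
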